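/- Let g be a finite-dimensional real Lie algebra of odd dimension that admits at least one ad-invariant inner product. Then there exist an ad-invariant inner product ⟨·,·⟩ on g, a vector ξ ∈ g, and a linear map φ : g → g such that (ξ, η, φ), with η(X) = ⟨ξ, X⟩, is an almost contact metric structure on (g, ⟨·,·⟩) which is normal, i.e. [φX, φY] + φ(φ([X,Y])) − φ([φX, Y]) − φ([X, φY]) − η([X,Y])ξ = 0 for all X, Y ∈ g. (This is the Lie-algebra formulation of the theorem that every odd-dimensional connected compact Lie group admits a left-invariant Sasaki-with-torsion structure; ad-invariance of the inner product makes the Reeb vector field ξ a Killing field.) -/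

import Mathlib

open Module

/-- A positive definite symmetric bilinear form on a real vector space, as an inner product. -/
@[reducible]
def innerCoreOfPosDef {V : Type*} [AddCommGroup V] [Module ℝ V] (B : V →ₗ[ℝ] V →ₗ[ℝ] ℝ)
    (hpos : ∀ X : V, X ≠ 0 → 0 < B X X) (hsymm : ∀ X Y : V, B X Y = B Y X) :
    InnerProductSpace.Core ℝ V where
  inner X Y := B X Y
  conj_inner_symm X Y := by simpa using hsymm Y X
  re_inner_nonneg X := by
    by_cases h : X = 0
    · simp [h]
    · simpa using (hpos X h).le
  add_left X Y Z := by simp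
  smul_left X Y r := by simp
  definite X h := by
    by_contra hX
    exact (hpos X hX).ne' h

/-- The spectral theorem for an operator symmetric with respect to a positive definite form. -/
theorem iSup_eigenspace_eq_top_of_posDef {V : Type*} [AddCommGroup V] [Module ℝ V]
    [Module.Finite ℝ V] (B : V →ₗ[ℝ] V →ₗ[ℝ] ℝ)
    (hpos : ∀ X : V, X ≠ 0 → 0 < B X X) (hsymm : ∀ X Y : V, B X Y = B Y X)
    (S : V →ₗ[ℝ] V) (hS : ∀ X Y, B (S X) Y = B X (S Y)) :
    ⨆ μ, End.eigenspace S μ = ⊤ := by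
  let c := innerCoreOfPosDef B hpos hsymm
  let : NormedAddCommGroup V := c.toNormedAddCommGroup
  let : InnerProductSpace ℝ V := InnerProductSpace.ofCore c.toCore
  have h : LinearMap.IsSymmetric S := fun X Y => hS X Y
  rw [← Submodule.orthogonal_eq_bot_iff]
  exact h.orthogonalComplement_iSup_eigenspaces_eq_bot

theorem exists_orthonormal_basis_of_posDef {V : Type*} [AddCommGroup V] [Module ℝ V]
    [Module.Finite ℝ V] (B : V →ₗ[ℝ] V →ₗ[ℝ] ℝ)
    (hpos : ∀ X : V, X ≠ 0 → 0 < B X X) (hsymm : ∀ X Y : V, B X Y = B Y X)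
    {ι : Type*} [Fintype ι] [DecidableEq ι] (hι : Fintype.card ι = finrank ℝ V) :
    ∃ b : Basis ι ℝ V, ∀ i j, B (b i) (b j) = if i = j then 1 else 0 := by
  let c := innerCoreOfPosDef B hpos hsymm
  let : NormedAddCommGroup V := c.toNormedAddCommGroup
  let : InnerProductSpace ℝ V := InnerProductSpace.ofCore c.toCore
  let b := (stdOrthonormalBasis ℝ V).reindex (Fintype.equivFinOfCardEq hι).symm
  refine ⟨b.toBasis, fun i j => ?_⟩
  have := orthonormal_iff_ite.1 b.orthonormal i j
  rw [b.coe_toBasis]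
  exact this

theorem even_finrank_of_comp_self_eq_neg {V : Type*} [AddCommGroup V] [Module ℝ V]
    (J : V →ₗ[ℝ] V) (hJ : ∀ X, J (J X) = -X) : Even (finrank ℝ V) := by
  by_contra h
  have hc : J * J = (-1 : ℝ) • (1 : V →ₗ[ℝ] V) := by
    ext X; simp [hJ]
  have hd := congrArg LinearMap.det hc
  rw [map_mul, LinearMap.det_smul, map_one, (Nat.not_even_iff_odd.1 h).neg_one_pow] at hd
  nlinarith [mul_self_nonneg (LinearMap.det J)]

/-- An odd-dimensional inner product space has an almost contact metric structure. -/
theorem exists_almostContact {V : Type*} [AddCommGroup V] [Module ℝ V]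
    [Module.Finite ℝ V] (hodd : Odd (finrank ℝ V)) (B : V →ₗ[ℝ] V →ₗ[ℝ] ℝ)
    (hpos : ∀ X : V, X ≠ 0 → 0 < B X X) (hsymm : ∀ X Y : V, B X Y = B Y X) :
    ∃ (ξ : V) (φ : V →ₗ[ℝ] V), B ξ ξ = 1 ∧ φ ξ = 0 ∧
      (∀ X, φ (φ X) = -X + (B ξ X) • ξ) ∧ (∀ X Y, B (φ X) Y = -B X (φ Y)) := by
  obtain ⟨k, hk⟩ := hodd
  obtain ⟨b, hb⟩ := exists_orthonormal_basis_of_posDef B hpos hsymm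
    (ι := Unit ⊕ (Fin k ⊕ Fin k)) (by simp [hk]; ring)
  let φ : V →ₗ[ℝ] V := b.constr ℝ
    (Sum.elim (fun _ => 0) (Sum.elim (fun i => b (.inr (.inr i))) (fun i => -b (.inr (.inl i)))))
  have h0 : ∀ u, φ (b (.inl u)) = 0 := fun u => by simp [φ]
  have h1 : ∀ i, φ (b (.inr (.inl i))) = b (.inr (.inr i)) := fun i => by simp [φ]
  have h2 : ∀ i, φ (b (.inr (.inr i))) = -b (.inr (.inl i)) := fun i => by simp [φ]
  refine ⟨b (.inl ()), φ, by simp [hb], h0 _, fun X => ?_, fun X Y => ?_⟩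
  · have : φ ∘ₗ φ = -LinearMap.id + (B (b (.inl ()))).smulRight (b (.inl ())) := by
      refine b.ext fun i => ?_
      rcases i with _ | i | i <;> simp [h0, h1, h2, hb]
    simpa using LinearMap.congr_fun this X
  · have : B ∘ₗ φ = -(B.compl₂ φ) := by
      refine b.ext fun i => b.ext fun j => ?_
      rcases i with _ | i | i <;> rcases j with _ | j | j <;> simp [h0, h1, h2, hb]
    simpa using LinearMap.congr_fun₂ this X Y

section Skew

variable {V : Type*} [AddCommGroup V] [Module ℝ V] [Module.Finite ℝ V]

/-- The space on which `D` is skew is spanned by the kernel of `D` and its planes of rotation. -/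
theorem skew_induction (B : V →ₗ[ℝ] V →ₗ[ℝ] ℝ)
    (hpos : ∀ X : V, X ≠ 0 → 0 < B X X) (hsymm : ∀ X Y : V, B X Y = B Y X)
    (D : V →ₗ[ℝ] V) (hD : ∀ X Y, B (D X) Y = -B X (D Y)) {p : V → Prop}
    (hadd : ∀ X Y, p X → p Y → p (X + Y)) (hker : ∀ X, D X = 0 → p X)
    (hrot : ∀ (a : ℝ) (X : V), 0 < a → D (D X) = -(a ^ 2) • X → p X) (X : V) : p X := by
  have htop := iSup_eigenspace_eq_top_of_posDef B hpos hsymm (-(D ∘ₗ D))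
    (fun X Y => by simp [hD])
  have hX : X ∈ ⨆ μ, End.eigenspace (-(D ∘ₗ D)) μ := htop ▸ Submodule.mem_top
  refine Submodule.iSup_induction _ (motive := p) hX (fun μ Y hY => ?_) (hker 0 (map_zero D)) hadd
  rw [End.mem_eigenspace_iff] at hY
  have hDD : D (D Y) = -μ • Y := by
    rw [neg_smul, ← hY]; simp
  by_cases hY0 : D Y = 0
  · exact hker Y hY0
  have hYne : Y ≠ 0 := fun h => hY0 (by simp [h])
  have h1 : B (D Y) (D Y) = μ * B Y Y := by
    rw [hD, hDD]; simp
  have hμ : 0 < μ := by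
    have h2 := hpos _ hY0
    rw [h1] at h2
    exact pos_of_mul_pos_left h2 (hpos _ hYne).le
  exact hrot (√μ) Y (Real.sqrt_pos.2 hμ) (by rw [Real.sq_sqrt hμ.le, hDD])

/-- The orthogonal part of the polar decomposition of a skew operator. -/
theorem exists_rotation (D : V →ₗ[ℝ] V) :
    ∃ J : V →ₗ[ℝ] V, (∀ X, D X = 0 → J X = 0) ∧
      ∀ (a : ℝ) (X : V), 0 < a → D (D X) = -(a ^ 2) • X → J X = a⁻¹ • D X := by
  let S : End ℝ V := -(D ∘ₗ D)
  have hfin : Set.Finite {μ | End.HasEigenvalue S μ} := End.finite_hasEigenvalue S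
  let p := Lagrange.interpolate hfin.toFinset id (fun μ : ℝ => (√μ)⁻¹)
  refine ⟨D ∘ₗ Polynomial.aeval S p, fun X hX => ?_, fun a X ha hX => ?_⟩
  · have hS : S X = (0 : ℝ) • X := by simp [S, hX]
    by_cases h0 : X = 0
    · simp [h0]
    · have := End.aeval_apply_of_hasEigenvector (p := p) ⟨End.mem_eigenspace_iff.2 hS, h0⟩
      simp [this, hX]
  · by_cases h0 : X = 0
    · simp [h0]
    have hS : End.HasEigenvector S (a ^ 2) X :=
      ⟨End.mem_eigenspace_iff.2 (by simp [S, hX]), h0⟩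
    have hmem : a ^ 2 ∈ hfin.toFinset := by
      simpa using End.hasEigenvalue_of_hasEigenvector hS
    have hp : p.eval (a ^ 2) = a⁻¹ := by
      have := Lagrange.eval_interpolate_at_node (fun μ : ℝ => (√μ)⁻¹)
        (v := id) (s := hfin.toFinset) Function.injective_id.injOn hmem
      simpa [p, Real.sqrt_sq ha.le] using this
    simp [End.aeval_apply_of_hasEigenvector hS, hp]

theorem rotation_skew (B : V →ₗ[ℝ] V →ₗ[ℝ] ℝ)
    (hpos : ∀ X : V, X ≠ 0 → 0 < B X X) (hsymm : ∀ X Y : V, B X Y = B Y X)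
    (D : V →ₗ[ℝ] V) (hD : ∀ X Y, B (D X) Y = -B X (D Y)) (J : V →ₗ[ℝ] V)
    (hJ0 : ∀ X, D X = 0 → J X = 0)
    (hJ : ∀ (a : ℝ) (X : V), 0 < a → D (D X) = -(a ^ 2) • X → J X = a⁻¹ • D X) (X Y : V) :
    B (J X) Y = -B X (J Y) := by
  refine skew_induction B hpos hsymm D hD (p := fun X => B (J X) Y = -B X (J Y))
    (fun X X' h h' => by simp [h, h']; ring) (fun X hX => ?_) (fun a X ha hX => ?_) X
  · refine skew_induction B hpos hsymm D hD (p := fun Y => B (J X) Y = -B X (J Y))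
      (fun X X' h h' => by simp [h, h']; ring) (fun Y hY => ?_) (fun b Y hb hY => ?_) Y
    · simp [hJ0 X hX, hJ0 Y hY]
    · have h : B X (D Y) = 0 := by simpa [hX] using hD X Y
      simp [hJ0 X hX, hJ b Y hb hY, h]
  · refine skew_induction B hpos hsymm D hD (p := fun Y => B (J X) Y = -B X (J Y))
      (fun X X' h h' => by simp [h, h']; ring) (fun Y hY => ?_) (fun b Y hb hY => ?_) Y
    · have h : B (D X) Y = 0 := by simpa [hY] using hD X Y
      simp [hJ a X ha hX, hJ0 Y hY, h]
    · rw [hJ a X ha hX, hJ b Y hb hY]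
      by_cases hab : a = b
      · simp [hab, hD]
      have h1 : (a ^ 2 - b ^ 2) * B (D X) Y = 0 := by
        have h2 : B (D (D (D X))) Y = B (D X) (D (D Y)) := by
          rw [hD (D (D X)), hD (D X), neg_neg]
        rw [hX, hY] at h2
        simp only [map_smul, LinearMap.smul_apply, smul_eq_mul] at h2
        linarith
      have h3 : a ^ 2 - b ^ 2 ≠ 0 := by
        rw [sq_sub_sq]
        exact mul_ne_zero (by positivity) (sub_ne_zero.2 hab)
      have h4 : B (D X) Y = 0 := (mul_eq_zero.1 h1).resolve_left h3
      have h5 : B X (D Y) = 0 := by linarith [hD X Y]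
      simp [h4, h5]

end Skew

/-- Every ad-invariant inner product on an odd-dimensional Lie algebra admits a normal almost
contact metric structure. The proof descends to centralizers of non-central elements. -/
theorem exists_normal_almostContact {g : Type*} [LieRing g] [LieAlgebra ℝ g] [Module.Finite ℝ g]
    (hodd : Odd (finrank ℝ g)) (B : g →ₗ[ℝ] g →ₗ[ℝ] ℝ)
    (hpos : ∀ X : g, X ≠ 0 → 0 < B X X) (hsymm : ∀ X Y : g, B X Y = B Y X)
    (hinv : ∀ X Y Z : g, B ⁅X, Y⁆ Z + B Y ⁅X, Z⁆ = 0) :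
    ∃ (ξ : g) (φ : g →ₗ[ℝ] g), B ξ ξ = 1 ∧ φ ξ = 0 ∧
      (∀ X, φ (φ X) = -X + (B ξ X) • ξ) ∧ (∀ X Y, B (φ X) Y = -B X (φ Y)) ∧
      (∀ X Y, ⁅φ X, φ Y⁆ - ⁅X, Y⁆ - φ ⁅φ X, Y⁆ - φ ⁅X, φ Y⁆ = 0) := by
  induction hn : finrank ℝ g using Nat.strong_induction_on generalizing g with
  | _ n ih =>
  by_cases hab : ∀ X Y : g, ⁅X, Y⁆ = 0
  · obtain ⟨ξ, φ, h1, h2, h3, h4⟩ := exists_almostContact hodd B hpos hsymm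
    exact ⟨ξ, φ, h1, h2, h3, h4, fun X Y => by simp [hab]⟩
  push Not at hab
  obtain ⟨H, Y₀, hHY⟩ := hab
  let D : g →ₗ[ℝ] g := LieAlgebra.ad ℝ g H
  have hDH : ∀ X, D X = ⁅H, X⁆ := fun X => rfl
  have hDer : ∀ X Y, D ⁅X, Y⁆ = ⁅D X, Y⁆ + ⁅X, D Y⁆ := fun X Y => by simp [hDH]
  have hD : ∀ X Y, B (D X) Y = -B X (D Y) := fun X Y => by
    rw [hDH, hDH, eq_neg_iff_add_eq_zero, hinv]
  obtain ⟨J, hJ0, hJ⟩ := exists_rotation D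
  have hJs := rotation_skew B hpos hsymm D hD J hJ0 hJ
  have hJJ : ∀ (a : ℝ) (X : g), 0 < a → D (D X) = -(a ^ 2) • X → J (J X) = -X := by
    intro a X ha hX
    have h1 : D (D (D X)) = -(a ^ 2) • D X := by rw [hX, map_smul]
    rw [hJ a X ha hX, map_smul, hJ a _ ha h1, hX, smul_smul, smul_smul,
      show a⁻¹ * a⁻¹ * -a ^ 2 = -1 by field_simp]
    simp
  let C : LieSubalgebra ℝ g :=
    { LinearMap.ker D with
      lie_mem' := by
        intro X Y hX hY
        have hX' : D X = 0 := hX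
        have hY' : D Y = 0 := hY
        change D ⁅X, Y⁆ = 0
        simp [hDer, hX', hY'] }
  have hPmem : ∀ X, D (X + J (J X)) = 0 := by
    refine skew_induction B hpos hsymm D hD (fun X Y h h' => ?_) (fun X hX => ?_)
      (fun a X ha hX => ?_)
    · have := congrArg₂ (· + ·) h h'
      simp only [map_add, add_zero] at this ⊢
      rw [← this]; abel
    · simp [hJ0 X hX, hX]
    · simp [hJJ a X ha hX]
  have : Module.Finite ℝ C := inferInstanceAs (Module.Finite ℝ C.toSubmodule)
  have hker : LinearMap.ker J = LinearMap.ker D := by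
    ext X
    simp only [LinearMap.mem_ker]
    refine ⟨fun h => ?_, hJ0 X⟩
    simpa [h] using hPmem X
  have hrk : finrank ℝ (LinearMap.range J) + finrank ℝ C = finrank ℝ g := by
    rw [← J.finrank_range_add_finrank_ker, hker]; rfl
  have hJJJ : ∀ X, J (J (J X)) = -J X := fun X => by
    have := hJ0 _ (hPmem X)
    rw [map_add] at this
    exact (neg_eq_of_add_eq_zero_right this).symm
  have hev : Even (finrank ℝ (LinearMap.range J)) := by
    refine even_finrank_of_comp_self_eq_neg
      (J.restrict (p := LinearMap.range J) (q := LinearMap.range J) fun X _ => ⟨X, rfl⟩) ?_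
    rintro ⟨_, X, rfl⟩
    exact Subtype.ext (hJJJ X)
  have hCodd : Odd (finrank ℝ C) := by
    rw [← hrk] at hodd
    exact (Nat.odd_add'.1 hodd).2 hev
  have hlt : finrank ℝ C < n := by
    rw [← hn]
    refine Submodule.finrank_lt (s := C.toSubmodule) fun h => hHY ?_
    have : Y₀ ∈ C.toSubmodule := h ▸ Submodule.mem_top
    exact this
  obtain ⟨ξ, φ₀, h1, h2, h3, h4, h5⟩ := ih _ hlt hCodd
    (B.domRestrict₁₂ C.toSubmodule C.toSubmodule)
    (fun X hX => hpos X (fun h => hX (Subtype.ext h))) (fun X Y => hsymm X Y)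
    (fun X Y Z => hinv X Y Z) rfl
  let P : g →ₗ[ℝ] C := LinearMap.codRestrict C.toSubmodule (LinearMap.id + J ∘ₗ J) hPmem
  have hPv : ∀ X, (P X : g) = X + J (J X) := fun X => rfl
  let φ : g →ₗ[ℝ] g := C.toSubmodule.subtype ∘ₗ φ₀ ∘ₗ P + J
  have hφv : ∀ X, φ X = φ₀ (P X) + J X := fun X => rfl
  have hφC : ∀ X : C, φ X = φ₀ X := fun X => by
    have hX : J X = 0 := hJ0 _ X.2
    have : P X = X := Subtype.ext (by simp [hPv, hX])
    simp [hφv, this, hX]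
  have hφR : ∀ (a : ℝ) (X : g), 0 < a → D (D X) = -(a ^ 2) • X → φ X = a⁻¹ • D X := by
    intro a X ha hX
    have : P X = 0 := Subtype.ext (by simp [hPv, hJJ a X ha hX])
    simp [hφv, this, hJ a X ha hX]
  have hφDX : ∀ (a : ℝ) (X : g), 0 < a → D (D X) = -(a ^ 2) • X → φ (D X) = -a • X := by
    intro a X ha hX
    rw [hφR a (D X) ha (by rw [hX, map_smul]), hX, smul_smul]
    congr 1
    field_simp
  have hDξ : ∀ X : C, D X = 0 := fun X => X.2
  have hφφ : ∀ X, φ (φ X) = -X + (B ξ X) • (ξ : g) := by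
    refine skew_induction B hpos hsymm D hD (fun X Y h h' => ?_) (fun X hX => ?_)
      (fun a X ha hX => ?_)
    · simp only [map_add, h, h', add_smul]; abel
    · have := congrArg (Subtype.val) (h3 ⟨X, hX⟩)
      have e : φ X = φ₀ ⟨X, hX⟩ := hφC ⟨X, hX⟩
      rw [e, hφC, this]; rfl
    · have hz : B ξ X = 0 := by
        have h6 : B ξ (D (D X)) = 0 := by
          have := hD ξ (D X)
          rw [hDξ] at this
          simpa using this
        rw [hX] at h6
        simpa [ha.ne'] using h6
      rw [hφR a X ha hX, map_smul, hφDX a X ha hX, hz, smul_smul]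
      rw [show a⁻¹ * -a = -1 by field_simp]
      simp
  have hskew : ∀ X Y, B (φ X) Y = -B X (φ Y) := by
    intro X Y
    have hPs : ∀ (Z : C) (X : g), B Z X = B Z (P X) := fun Z X => by
      rw [hPv, map_add, ← neg_eq_iff_eq_neg.2 (hJs Z (J X)), hJ0 Z Z.2]; simp
    have h6 : B (φ₀ (P X)) (P Y) = -B (P X) (φ₀ (P Y)) := h4 (P X) (P Y)
    rw [hφv, hφv, map_add, map_add, LinearMap.add_apply, hJs, hPs, h6,
      hsymm X (φ₀ (P Y)), hPs (φ₀ (P Y)) X, hsymm (φ₀ (P Y)) (P X)]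
    ring
  have hCR : ∀ (X : C) (b : ℝ) (Y : g), 0 < b → D (D Y) = -(b ^ 2) • Y →
      φ ⁅(X : g), Y⁆ = b⁻¹ • ⁅(X : g), D Y⁆ ∧ φ ⁅(X : g), D Y⁆ = -b • ⁅(X : g), Y⁆ := by
    intro X b Y hb hY
    have h6 : ∀ Z, D ⁅(X : g), Z⁆ = ⁅(X : g), D Z⁆ := fun Z => by simp [hDer, hDξ]
    have h7 : D (D ⁅(X : g), Y⁆) = -(b ^ 2) • ⁅(X : g), Y⁆ := by
      rw [h6, h6, hY, lie_smul]
    refine ⟨?_, ?_⟩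
    · rw [hφR b _ hb h7, h6]
    · rw [← h6, hφDX b _ hb h7]
  have hNCR : ∀ (X : g) (b : ℝ) (Y : g), D X = 0 → 0 < b → D (D Y) = -(b ^ 2) • Y →
      ⁅φ X, φ Y⁆ - ⁅X, Y⁆ - φ ⁅φ X, Y⁆ - φ ⁅X, φ Y⁆ = 0 := by
    intro X b Y hX hb hY
    have e : φ X = φ₀ ⟨X, hX⟩ := hφC ⟨X, hX⟩
    rw [e, hφR b Y hb hY, lie_smul, lie_smul, map_smul, (hCR _ b Y hb hY).1,
      (hCR ⟨X, hX⟩ b Y hb hY).2, smul_smul, show b⁻¹ * -b = -1 by field_simp]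
    simp
  have hanti : ∀ X Y, ⁅φ X, φ Y⁆ - ⁅X, Y⁆ - φ ⁅φ X, Y⁆ - φ ⁅X, φ Y⁆ =
      -(⁅φ Y, φ X⁆ - ⁅Y, X⁆ - φ ⁅φ Y, X⁆ - φ ⁅Y, φ X⁆) := by
    intro X Y
    rw [← lie_skew (φ X) (φ Y), ← lie_skew X Y, ← lie_skew (φ X) Y, ← lie_skew X (φ Y),
      map_neg, map_neg]
    abel
  have hNRR : ∀ (a b : ℝ) (X Y : g), 0 < a → 0 < b → D (D X) = -(a ^ 2) • X →
      D (D Y) = -(b ^ 2) • Y → ⁅φ X, φ Y⁆ - ⁅X, Y⁆ - φ ⁅φ X, Y⁆ - φ ⁅X, φ Y⁆ = 0 := by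
    intro a b X Y ha hb hX hY
    have hDX : D X = a • φ X := by rw [hφR a X ha hX, smul_smul, mul_inv_cancel₀ ha.ne', one_smul]
    have hDY : D Y = b • φ Y := by rw [hφR b Y hb hY, smul_smul, mul_inv_cancel₀ hb.ne', one_smul]
    have hDφX : D (φ X) = -a • X := by
      rw [hφR a X ha hX, map_smul, hX, smul_smul]; congr 1; field_simp
    have hDφY : D (φ Y) = -b • Y := by
      rw [hφR b Y hb hY, map_smul, hY, smul_smul]; congr 1; field_simp
    have hDZ : D (⁅X, Y⁆ - ⁅φ X, φ Y⁆) = (a + b) • (⁅φ X, Y⁆ + ⁅X, φ Y⁆) := by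
      simp only [map_sub, hDer, hDX, hDY, hDφX, hDφY, lie_smul, smul_lie]
      module
    have hDW : D (⁅φ X, Y⁆ + ⁅X, φ Y⁆) = -(a + b) • (⁅X, Y⁆ - ⁅φ X, φ Y⁆) := by
      simp only [map_add, hDer, hDX, hDY, hDφX, hDφY, lie_smul, smul_lie]
      module
    have hW := hφR (a + b) (⁅φ X, Y⁆ + ⁅X, φ Y⁆) (by positivity) (by
      rw [hDW, map_smul, hDZ, smul_smul]; congr 1; ring)
    rw [hDW, smul_smul, show (a + b)⁻¹ * -(a + b) = -1 by field_simp, map_add] at hW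
    rw [sub_sub _ (φ _), hW]
    module
  refine ⟨ξ, φ, h1, ?_, hφφ, hskew, fun X Y => ?_⟩
  · rw [hφC, h2]; rfl
  refine skew_induction B hpos hsymm D hD
    (p := fun X => ⁅φ X, φ Y⁆ - ⁅X, Y⁆ - φ ⁅φ X, Y⁆ - φ ⁅X, φ Y⁆ = 0)
    (fun X X' h h' => ?_) (fun X hX => ?_) (fun a X ha hX => ?_) X
  · rw [← add_zero (0 : g)]
    nth_rewrite 1 [← h, ← h']
    simp only [map_add, add_lie]
    abel
  · refine skew_induction B hpos hsymm D hD
      (p := fun Y => ⁅φ X, φ Y⁆ - ⁅X, Y⁆ - φ ⁅φ X, Y⁆ - φ ⁅X, φ Y⁆ = 0)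
      (fun Y Y' h h' => ?_) (fun Y hY => ?_) (fun b Y hb hY => hNCR X b Y hX hb hY) Y
    · rw [← add_zero (0 : g)]
      nth_rewrite 1 [← h, ← h']
      simp only [map_add, lie_add]
      abel
    · have := congrArg (Subtype.val) (h5 ⟨X, hX⟩ ⟨Y, hY⟩)
      simpa [← hφC] using this
  · refine skew_induction B hpos hsymm D hD
      (p := fun Y => ⁅φ X, φ Y⁆ - ⁅X, Y⁆ - φ ⁅φ X, Y⁆ - φ ⁅X, φ Y⁆ = 0)
      (fun Y Y' h h' => ?_) (fun Y hY => ?_) (fun b Y hb hY => hNRR a b X Y ha hb hX hY) Y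
    · rw [← add_zero (0 : g)]
      nth_rewrite 1 [← h, ← h']
      simp only [map_add, lie_add]
      abel
    · rw [hanti, hNCR Y a X hY ha hX, neg_zero]


/-- Every odd-dimensional real Lie algebra admitting an ad-invariant inner product
carries a normal almost contact metric structure compatible with some ad-invariant
inner product (Lie-algebra formulation of: every odd-dimensional connected compact
Lie group admits a left-invariant Sasaki-with-torsion structure). -/
theorem stmt_0 (g : Type*) [LieRing g] [LieAlgebra ℝ g] [Module.Finite ℝ g]
    (hodd : Odd (Module.finrank ℝ g))
    (hexists : ∃ B : g →ₗ[ℝ] g →ₗ[ℝ] ℝ,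
      (∀ X : g, X ≠ 0 → 0 < B X X) ∧ (∀ X Y : g, B X Y = B Y X) ∧
      (∀ X Y Z : g, B ⁅X, Y⁆ Z + B Y ⁅X, Z⁆ = 0)) :
    ∃ (B : g →ₗ[ℝ] g →ₗ[ℝ] ℝ) (ξ : g) (φ : g →ₗ[ℝ] g),
      (∀ X : g, X ≠ 0 → 0 < B X X) ∧ (∀ X Y : g, B X Y = B Y X) ∧
      (∀ X Y Z : g, B ⁅X, Y⁆ Z + B Y ⁅X, Z⁆ = 0) ∧
      B ξ ξ = 1 ∧ φ ξ = 0 ∧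
      (∀ X : g, φ (φ X) = -X + (B ξ X) • ξ) ∧
      (∀ X Y : g, B (φ X) (φ Y) = B X Y - B ξ X * B ξ Y) ∧
      (∀ X Y : g,
        ⁅φ X, φ Y⁆ + φ (φ ⁅X, Y⁆) - φ ⁅φ X, Y⁆ - φ ⁅X, φ Y⁆ - (B ξ ⁅X, Y⁆) • ξ = 0) := by
  obtain ⟨B, hpos, hsymm, hinv⟩ := hexists
  obtain ⟨ξ, φ, h1, h2, h3, h4, h5⟩ := exists_normal_almostContact hodd B hpos hsymm hinv
  refine ⟨B, ξ, φ, hpos, hsymm, hinv, h1, h2, h3, fun X Y => ?_, fun X Y => ?_⟩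
  · rw [h4, h3, map_add, map_neg, map_smul, hsymm X ξ, smul_eq_mul]
    ring
  · rw [← h5 X Y, h3]
    abel
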